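/- Let S be a simple injective left A-module with endomorphism ring D = End(S), e a primitive idempotent of A with eS ≠ 0, B = A/AeA, and M = rad P(S), and assume M ≠ 0. Then the inclusion map M → P(S) is a left add(A)-approximation if and only if End_A(M) is isomorphic to D as a k-algebra and Hom_A(M, B) = 0 (where B is regarded as a left A-module). -/

import Mathlib

/-!
Common background: `A` is an artin algebra (an algebra over a commutative artinian
ring `k`, finitely generated as `k`-module).  Left `A`-modules are `Module A M`;
right `A`-modules are `Module Aᵐᵒᵖ N`.  `Dl A M = Hom_A(M,A)` is the `A`-dual of a
left module (a right module) and `Dr A N` the dual of a right module (a left module);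
`evalL A M : M → M**` is the canonical evaluation map `φ_M`.
-/

open CategoryTheory LinearMap

universe u

section Preliminaries

variable (A : Type u) [Ring A]

/-- The `A`-dual of a left `A`-module: `M* = Hom_A(M, A)`, a right `A`-module. -/
abbrev Dl (M : Type u) [AddCommGroup M] [Module A M] : Type u := M →ₗ[A] A

/-- The `A`-dual of a right `A`-module: a left `A`-module. -/
abbrev Dr (N : Type u) [AddCommGroup N] [Module Aᵐᵒᵖ N] : Type u := N →ₗ[Aᵐᵒᵖ] A

variable {A}

/-- The dual of a map of left modules. -/
def dualMapL {M N : Type u} [AddCommGroup M] [Module A M] [AddCommGroup N] [Module A N]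
    (g : M →ₗ[A] N) : Dl A N →ₗ[Aᵐᵒᵖ] Dl A M where
  toFun h := h.comp g
  map_add' h₁ h₂ := by ext; simp
  map_smul' a h := by ext; simp

/-- The dual of a map of right modules. -/
def dualMapR {M N : Type u} [AddCommGroup M] [Module Aᵐᵒᵖ M] [AddCommGroup N] [Module Aᵐᵒᵖ N]
    (g : M →ₗ[Aᵐᵒᵖ] N) : Dr A N →ₗ[A] Dr A M where
  toFun h := h.comp g
  map_add' h₁ h₂ := by ext; simp
  map_smul' a h := by ext; simp

variable (A)

/-- The canonical evaluation map `φ_M : M → M**` for a left module `M`. -/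
def evalL (M : Type u) [AddCommGroup M] [Module A M] : M →ₗ[A] Dr A (Dl A M) where
  toFun m :=
    { toFun := fun f => f m
      map_add' := fun f g => rfl
      map_smul' := fun a f => rfl }
  map_add' m m' := by ext f; simp
  map_smul' a m := by ext f; simp

/-- The canonical evaluation map `φ_N : N → N**` for a right module `N`. -/
def evalR (N : Type u) [AddCommGroup N] [Module Aᵐᵒᵖ N] : N →ₗ[Aᵐᵒᵖ] Dl A (Dr A N) where
  toFun n :=
    { toFun := fun f => f n
      map_add' := fun f g => rfl
      map_smul' := fun a f => rfl }
  map_add' n n' := by ext f; simp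
  map_smul' a n := by ext f; simp

/-- The radical of a module: the intersection of all maximal submodules. -/
def radM (M : Type u) [AddCommGroup M] [Module A M] : Submodule A M :=
  sInf {N : Submodule A M | IsCoatom N}

/-- A module is *reduced* if it has no nonzero projective direct summand. -/
def Reduced (M : Type u) [AddCommGroup M] [Module A M] : Prop :=
  ∀ N N' : Submodule A M, IsCompl N N' → Module.Projective A N → N = ⊥

/-- Vanishing of `Ext^i_A(M, N)`. -/
def extZero (M N : Type u) [AddCommGroup M] [Module A M] [AddCommGroup N] [Module A N]
    (i : ℕ) : Prop :=
  Limits.IsZero (((Ext ℤ (ModuleCat.{u} A) i).obj (Opposite.op (ModuleCat.of A M))).obj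
    (ModuleCat.of A N))

/-- A left module `M` is semi-Gorenstein-projective if `Ext^i_A(M, A) = 0` for all `i ≥ 1`. -/
def sGp (M : Type u) [AddCommGroup M] [Module A M] : Prop :=
  ∀ i : ℕ, 1 ≤ i → extZero A M A i

/-- Semi-Gorenstein-projectivity for right modules, with `A` as right regular module. -/
def sGpR (N : Type u) [AddCommGroup N] [Module Aᵐᵒᵖ N] : Prop :=
  ∀ i : ℕ, 1 ≤ i → extZero Aᵐᵒᵖ N A i

/-- `e : P → M` is a projective cover: `P` is a finitely generated projective module,
`e` is surjective and `ker e ⊆ rad P`. -/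
def IsProjCover {P M : Type u} [AddCommGroup P] [Module A P] [AddCommGroup M] [Module A M]
    (e : P →ₗ[A] M) : Prop :=
  Module.Projective A P ∧ Module.Finite A P ∧ Function.Surjective e ∧ ker e ≤ radM A P

/-- `P₁ →f P₀ →e M → 0` is a minimal projective presentation of `M`. -/
def IsMinPres {P₁ P₀ M : Type u} [AddCommGroup P₁] [Module A P₁] [AddCommGroup P₀] [Module A P₀]
    [AddCommGroup M] [Module A M] (f : P₁ →ₗ[A] P₀) (e : P₀ →ₗ[A] M) : Prop :=
  IsProjCover A e ∧ range f = ker e ∧ Module.Projective A P₁ ∧ Module.Finite A P₁ ∧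
    ker f ≤ radM A P₁

/-- A minimal projective resolution `⋯ → P₁ → P₀ → M → 0` (ℕ-indexed). -/
def IsMinProjRes (P : ℕ → Type u) [∀ n, AddCommGroup (P n)] [∀ n, Module A (P n)]
    {M : Type u} [AddCommGroup M] [Module A M]
    (f : ∀ n, P (n+1) →ₗ[A] P n) (e : P 0 →ₗ[A] M) : Prop :=
  (∀ n, Module.Projective A (P n)) ∧ (∀ n, Module.Finite A (P n)) ∧
    Function.Surjective e ∧ range (f 0) = ker e ∧ (∀ n, range (f (n+1)) = ker (f n)) ∧
    ker e ≤ radM A (P 0) ∧ (∀ n, ker (f n) ≤ radM A (P (n+1)))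

section ZComplex

variable (P : ℤ → Type u) [∀ i, AddCommGroup (P i)] [∀ i, Module A (P i)]
  (g : ∀ i : ℤ, P i →ₗ[A] P (i-1))

/-- `(P_i, g_i : P_i → P_{i-1})` is a complex. -/
def IsComplexZ : Prop := ∀ i : ℤ, (g (i-1)).comp (g i) = 0

/-- A complex is minimal if each image lies in the radical. -/
def IsMinimalZ : Prop := ∀ i : ℤ, range (g i) ≤ radM A (P (i-1))

/-- A complex of (finitely generated) projective modules. -/
def IsProjComplexZ : Prop := ∀ i : ℤ, Module.Projective A (P i) ∧ Module.Finite A (P i)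

/-- Exactness at position `i - 1`, i.e. `H_{i-1}(P_•) = 0`. -/
def ExactAtPred (i : ℤ) : Prop := range (g i) = ker (g (i-1))

/-- Acyclicity of the `A`-dual complex `P_•^*`. -/
def DualAcyclicZ : Prop :=
  ∀ i : ℤ, range (dualMapL (g (i-1))) = ker (dualMapL (g i))

/-- The homology of the complex at position `i - 1`. -/
abbrev HomologyAtPred (i : ℤ) : Type u :=
  ↥(ker (g (i-1))) ⧸ (Submodule.comap (ker (g (i-1))).subtype (range (g i)))

end ZComplex

/-- `Z` is (a representative of) the transpose `Tr M` of the left module `M`. -/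
def IsTrL (M : Type u) [AddCommGroup M] [Module A M]
    (Z : Type u) [AddCommGroup Z] [Module Aᵐᵒᵖ Z] : Prop :=
  ∃ (P₁ P₀ : ModuleCat.{u} A) (f : P₁ →ₗ[A] P₀) (e : P₀ →ₗ[A] M),
    IsMinPres A f e ∧ Nonempty (Z ≃ₗ[Aᵐᵒᵖ] (Dl A P₁ ⧸ range (dualMapL f)))

/-- `M` is (a representative of) the transpose `Tr Z` of the right module `Z`. -/
def IsTrR (Z : Type u) [AddCommGroup Z] [Module Aᵐᵒᵖ Z]
    (M : Type u) [AddCommGroup M] [Module A M] : Prop :=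
  ∃ (Q₁ Q₀ : ModuleCat.{u} Aᵐᵒᵖ) (d : Q₁ →ₗ[Aᵐᵒᵖ] Q₀) (c : Q₀ →ₗ[Aᵐᵒᵖ] Z),
    IsMinPres Aᵐᵒᵖ d c ∧ Nonempty (M ≃ₗ[A] (Dr A Q₁ ⧸ range (dualMapR d)))

/-- `W` is (a representative of) the syzygy `Ω M` of the left module `M`. -/
def IsSyzL (W M : Type u) [AddCommGroup W] [Module A W] [AddCommGroup M] [Module A M] : Prop :=
  ∃ (P : ModuleCat.{u} A) (e : P →ₗ[A] M),
    IsProjCover A e ∧ Nonempty (W ≃ₗ[A] ker e)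

/-- `W` is (a representative of) the syzygy `Ω Z` of the right module `Z`. -/
def IsSyzR (W Z : Type u) [AddCommGroup W] [Module Aᵐᵒᵖ W] [AddCommGroup Z] [Module Aᵐᵒᵖ Z] :
    Prop :=
  ∃ (Q : ModuleCat.{u} Aᵐᵒᵖ) (c : Q →ₗ[Aᵐᵒᵖ] Z),
    IsProjCover Aᵐᵒᵖ c ∧ Nonempty (W ≃ₗ[Aᵐᵒᵖ] ker c)

/-- `W` is a second syzygy `Ω² M`. -/
def IsSyz2L (W M : Type u) [AddCommGroup W] [Module A W] [AddCommGroup M] [Module A M] : Prop :=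
  ∃ (V : ModuleCat.{u} A), IsSyzL A V M ∧ IsSyzL A W V

/-- `W` is a second syzygy `Ω² Z` of a right module. -/
def IsSyz2R (W Z : Type u) [AddCommGroup W] [Module Aᵐᵒᵖ W] [AddCommGroup Z] [Module Aᵐᵒᵖ Z] :
    Prop :=
  ∃ (V : ModuleCat.{u} Aᵐᵒᵖ), IsSyzR A V Z ∧ IsSyzR A W V

/-- A right module `Z` is ∞-torsionfree if its transpose is semi-Gorenstein-projective. -/
def InfTfR (Z : Type u) [AddCommGroup Z] [Module Aᵐᵒᵖ Z] : Prop :=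
  ∃ (M : ModuleCat.{u} A), IsTrR A Z M ∧ sGp A M

/-- A left module `M` is ∞-torsionfree if its transpose is semi-Gorenstein-projective. -/
def InfTfL (M : Type u) [AddCommGroup M] [Module A M] : Prop :=
  ∃ (Z : ModuleCat.{u} Aᵐᵒᵖ), IsTrL A M Z ∧ sGpR A Z

/-- Projective dimension at most `n` (for objects of `ModuleCat A`). -/
def projDimLEcat : ℕ → ModuleCat.{u} A → Prop
  | 0, M => Module.Projective A M
  | (n+1), M => ∃ (P : ModuleCat.{u} A) (e : P →ₗ[A] M),
      Module.Projective A P ∧ Module.Finite A P ∧ Function.Surjective e ∧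
        projDimLEcat n (ModuleCat.of A (ker e))

/-- Projective dimension at most `n`. -/
def projDimLE (M : Type u) [AddCommGroup M] [Module A M] (n : ℕ) : Prop :=
  projDimLEcat A n (ModuleCat.of A M)

/-- A Nunke module: a semi-Gorenstein-projective module `M` with `M* = 0`. -/
def NunkeL (M : Type u) [AddCommGroup M] [Module A M] : Prop :=
  sGp A M ∧ ∀ f : Dl A M, f = 0

end Preliminaries


/-- The factor algebra `B = A / AeA`, the quotient of `A` by the two-sided ideal
generated by the idempotent `e`. -/
abbrev Bquot (A : Type u) [Ring A] (e : A) : Type u := (TwoSidedIdeal.span {e}).ringCon.Quotient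

/-- The quotient map `A → B = A/AeA`. -/
abbrev Bproj (A : Type u) [Ring A] (e : A) : A →+* Bquot A e := (TwoSidedIdeal.span {e}).ringCon.mk'

/-- `e` is a primitive idempotent of `A`. -/
def IsPrimIdem (A : Type u) [Ring A] (e : A) : Prop :=
  IsIdempotentElem e ∧ e ≠ 0 ∧
    ∀ a b : A, IsIdempotentElem a → IsIdempotentElem b → a * b = 0 → b * a = 0 →
      e = a + b → a = 0 ∨ b = 0

/-- `ι : M' → P` is a left `add(A)`-approximation: `P` is a finitely generated projective
module and every homomorphism from `M'` to a projective module factors through `ι`. -/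
def IsLeftAddApprox (A : Type u) [Ring A] {M' P : Type u} [AddCommGroup M'] [Module A M']
    [AddCommGroup P] [Module A P] (iota : M' →ₗ[A] P) : Prop :=
  Module.Projective A P ∧ Module.Finite A P ∧
    ∀ (P' : ModuleCat.{u} A), Module.Projective A (↥P') → ∀ g : M' →ₗ[A] (↥P'),
      ∃ h : P →ₗ[A] (↥P'), h ∘ₗ iota = g

/-- For `c : k`, the central `A`-linear endomorphism `x ↦ (algebraMap k A c) • x`.
These maps give the `k`-algebra structure on `End_A(X)`; a ring isomorphism of
endomorphism rings is a `k`-algebra isomorphism iff it matches them up. -/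
def centralSMul (k A : Type u) [CommRing k] [Ring A] [Algebra k A] (c : k)
    (X : Type u) [AddCommGroup X] [Module A X] : Module.End A X where
  toFun x := algebraMap k A c • x
  map_add' x y := smul_add _ x y
  map_smul' a x := by simp only [RingHom.id_apply, ← mul_smul, Algebra.commutes]

section RadicalApproximation

variable {A : Type u} [Ring A]

/-- A linear map whose kernel contains that of a surjection factors through the surjection. -/
theorem exists_comp_eq_of_ker_le {X Y Z : Type*} [AddCommGroup X] [Module A X]
    [AddCommGroup Y] [Module A Y] [AddCommGroup Z] [Module A Z]
    (f : X →ₗ[A] Y) (hf : Function.Surjective f) (g : X →ₗ[A] Z) (h : ker f ≤ ker g) :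
    ∃ l : Y →ₗ[A] Z, ∀ x, l (f x) = g x := by
  refine ⟨(ker f).liftQ g h ∘ₗ (f.quotKerEquivOfSurjective hf).symm.toLinearMap, fun x => ?_⟩
  have : (f.quotKerEquivOfSurjective hf).symm (f x) = Submodule.Quotient.mk x := by
    rw [LinearEquiv.symm_apply_eq]
    rfl
  simp [this]

/-- Every map to a simple module vanishes on the radical. -/
theorem radM_le_ker {X S : Type u} [AddCommGroup X] [Module A X] [AddCommGroup S] [Module A S]
    [IsSimpleModule A S] (h : X →ₗ[A] S) : radM A X ≤ ker h := by
  by_cases h0 : h = 0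
  · simp [h0]
  · exact sInf_le (LinearMap.isCoatom_ker_of_surjective (LinearMap.surjective_of_ne_zero h0))

variable {S P : Type u} [AddCommGroup S] [Module A S] [IsSimpleModule A S]
  [AddCommGroup P] [Module A P] {π : P →ₗ[A] S}

theorem IsProjCover.ker_eq_radM (hcov : IsProjCover A π) : ker π = radM A P :=
  le_antisymm hcov.2.2.2 (radM_le_ker π)

theorem IsProjCover.ne_zero (hcov : IsProjCover A π) : π ≠ 0 := by
  have := IsSimpleModule.nontrivial A S
  obtain ⟨s, hs⟩ := exists_ne (0 : S)
  obtain ⟨p, rfl⟩ := hcov.2.2.1 s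
  rintro rfl
  exact hs rfl

/-- The projective cover of a simple module is a local module. -/
theorem IsProjCover.le_ker_of_ne_top (hcov : IsProjCover A π) {N : Submodule A P} (hN : N ≠ ⊤) :
    N ≤ ker π := by
  have := hcov.2.1
  obtain ⟨L, hL, hNL⟩ := (eq_top_or_exists_le_coatom N).resolve_left hN
  have hk : IsCoatom (ker π) := LinearMap.isCoatom_ker_of_surjective hcov.2.2.1
  have h1 : ker π ≤ L := hcov.ker_eq_radM.trans_le (sInf_le hL)
  rcases hk.le_iff.1 h1 with h | h
  · exact absurd h hL.1
  · exact h ▸ hNL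

/-- If `S` is injective, any nonzero map `P(S) → X` yields a map `X → S` extending
the projective cover. -/
theorem IsProjCover.exists_comp_eq (hcov : IsProjCover A π) (hinj : Module.Injective A S)
    {X : Type u} [AddCommGroup X] [Module A X] {f : P →ₗ[A] X} (hf : f ≠ 0) :
    ∃ h : X →ₗ[A] S, ∀ p, h (f p) = π p := by
  have hk : ker f ≤ ker π := hcov.le_ker_of_ne_top (by rwa [Ne, LinearMap.ker_eq_top])
  obtain ⟨l, hl⟩ := exists_comp_eq_of_ker_le f.rangeRestrict f.surjective_rangeRestrict π
    (by rwa [LinearMap.ker_rangeRestrict])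
  obtain ⟨h, hh⟩ := hinj.out (range f).subtype (Submodule.subtype_injective _) l
  exact ⟨h, fun p => by rw [← hl p, ← hh]; rfl⟩

/-- If `S` is injective, an endomorphism of `P(S)` with image in the radical is zero. -/
theorem IsProjCover.eq_zero_of_comp_eq_zero (hcov : IsProjCover A π) (hinj : Module.Injective A S)
    {f : P →ₗ[A] P} (hf : ∀ p, π (f p) = 0) : f = 0 := by
  by_contra h0
  obtain ⟨h, hh⟩ := hcov.exists_comp_eq hinj h0
  refine hcov.ne_zero (LinearMap.ext fun p => ?_)
  rw [← hh p]
  exact radM_le_ker h (hcov.ker_eq_radM.le (hf p))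

theorem IsProjCover.endomorphism_ext (hcov : IsProjCover A π) (hinj : Module.Injective A S)
    {f g : P →ₗ[A] P} (h : ∀ p, π (f p) = π (g p)) : f = g :=
  sub_eq_zero.1 (hcov.eq_zero_of_comp_eq_zero hinj fun p => by simp [h p])

/-- `P(S)` is isomorphic to `Ae`: it is generated by an element `p` with `e p = p`, and
such elements map to arbitrary elements of the form `e x`. -/
theorem IsProjCover.exists_generator (hcov : IsProjCover A π) {e : A} (he : IsPrimIdem A e)
    (heS : ∃ s : S, e • s ≠ 0) :
    ∃ p : P, e • p = p ∧ p ≠ 0 ∧ Submodule.span A {p} = ⊤ ∧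
      ∀ (X : Type u) [AddCommGroup X] [Module A X] (x : X), ∃ f : P →ₗ[A] X, f p = e • x := by
  obtain ⟨hid, -, hprim⟩ := he
  have := hcov.1
  obtain ⟨s, hs⟩ := heS
  obtain ⟨p', rfl⟩ := hcov.2.2.1 s
  have hp : e • e • p' = e • p' := by rw [← mul_smul, hid.eq]
  generalize hpe : e • p' = p at hp
  have hπp : π p ≠ 0 := by rwa [← hpe, map_smul]
  have hp0 : p ≠ 0 := by rintro rfl; exact hπp (map_zero _)
  have htop : Submodule.span A {p} = ⊤ := by
    by_contra h
    exact hπp (hcov.le_ker_of_ne_top h (Submodule.mem_span_singleton_self p))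
  refine ⟨p, hp, hp0, htop, ?_⟩
  have hsurj : Function.Surjective (LinearMap.toSpanSingleton A P p) := by
    rw [← LinearMap.range_eq_top, LinearMap.range_toSpanSingleton, htop]
  obtain ⟨w, hw⟩ := Module.projective_lifting_property _ LinearMap.id hsurj
  have hcp : w p • p = p := by simpa using LinearMap.congr_fun hw p
  have hec : e * w p = w p := by rw [← smul_eq_mul, ← map_smul, hp]
  have hcc : w p * w p = w p := by rw [← smul_eq_mul, ← map_smul, hcp]
  have haa : w p * e * (w p * e) = w p * e := by
    rw [mul_assoc, ← mul_assoc e, hec, ← mul_assoc, hcc]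
  have hea : e * (w p * e) = w p * e := by rw [← mul_assoc, hec]
  have hae : w p * e * e = w p * e := by rw [mul_assoc, hid.eq]
  have hce : w p * e = e := by
    rcases hprim (w p * e) (e - w p * e) haa
      (by simp only [IsIdempotentElem, mul_sub, sub_mul, hid.eq, haa, hea, hae]; abel)
      (by rw [mul_sub, hae, haa, sub_self]) (by rw [sub_mul, hea, haa, sub_self])
      (by abel) with h | h
    · refine absurd ?_ hp0
      have : (w p * e) • p = p := by rw [mul_smul, hp, hcp]
      rw [← this, h, zero_smul]
    · exact (sub_eq_zero.1 h).symm
  exact fun X _ _ x => ⟨LinearMap.toSpanSingleton A X (e • x) ∘ₗ w, by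
    simp [← mul_smul, hce]⟩

/-- Sums of endomorphisms of `X` that factor through `P`. -/
def factorThrough (P X : Type u) [AddCommGroup P] [Module A P] [AddCommGroup X] [Module A X] :
    AddSubgroup (X →ₗ[A] X) :=
  AddSubgroup.closure {t | ∃ (s : P →ₗ[A] X) (q : X →ₗ[A] P), t = s ∘ₗ q}

/-- An artinian projective module `X` decomposes as a direct sum of copies of `P(S)` and a module
annihilated by `e`; here `r` is the projection on the latter. -/
theorem IsProjCover.exists_projection (hcov : IsProjCover A π) (hinj : Module.Injective A S)
    {e : A} (he : IsPrimIdem A e) (heS : ∃ s : S, e • s ≠ 0)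
    (X : Type u) [AddCommGroup X] [Module A X] [Module.Projective A X] [IsArtinian A X] :
    ∃ r : X →ₗ[A] X, (∀ x, e • r x = 0) ∧ LinearMap.id - r ∈ factorThrough P X := by
  obtain ⟨p, hp, hp0, htop, hex⟩ := hcov.exists_generator he heS
  let R : Set (Submodule A X) := {N | ∃ r : X →ₗ[A] X, (∀ x, r (r x) = r x) ∧
    LinearMap.id - r ∈ factorThrough P X ∧ range r = N}
  have hR : R.Nonempty :=
    ⟨_, LinearMap.id, fun _ => rfl, by rw [sub_self]; exact zero_mem _, rfl⟩
  obtain ⟨N, ⟨r, hrr, hrI, rfl⟩, hmin⟩ := wellFounded_lt.has_min R hR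
  refine ⟨r, ?_, hrI⟩
  by_contra! hne
  obtain ⟨y, hy⟩ := hne
  obtain ⟨f, hf⟩ := hex X (r y)
  have hf0 : f ≠ 0 := by rintro rfl; exact hy hf.symm
  have hrf : ∀ z, r (f z) = f z := by
    have : r ∘ₗ f = f := by
      refine LinearMap.ext_on htop fun z hz => ?_
      obtain rfl : z = p := hz
      simp [hf, hrr]
    exact LinearMap.congr_fun this
  obtain ⟨h, hh⟩ := hcov.exists_comp_eq hinj hf0
  obtain ⟨q, hq⟩ := Module.projective_lifting_property π h hcov.2.2.1
  have hqf : ∀ z, q (f z) = z := by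
    have : q ∘ₗ f = LinearMap.id := hcov.endomorphism_ext hinj fun z => by
      rw [LinearMap.comp_apply, ← LinearMap.comp_apply π, hq, hh, LinearMap.id_apply]
    exact LinearMap.congr_fun this
  refine hmin _ ⟨r - f ∘ₗ (q ∘ₗ r), fun x => by simp [hrr, hrf, hqf], ?_, rfl⟩ (lt_of_le_of_ne ?_ ?_)
  · rw [sub_sub_eq_add_sub, add_sub_right_comm]
    exact add_mem hrI (AddSubgroup.subset_closure ⟨_, _, rfl⟩)
  · rintro _ ⟨x, rfl⟩
    exact ⟨x - f (q (r x)), by simp [hrf]⟩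
  · intro heq
    have hmem : f p ∈ range r := ⟨f p, hrf p⟩
    rw [← heq] at hmem
    obtain ⟨z, hz⟩ := hmem
    have h1 : f p = 0 := by
      rw [← hz]
      have h2 := congrArg (fun t => r t - f (q (r t))) hz
      simp [hrr, hrf, hqf] at h2
      simpa using h2
    exact hp0 (by rw [← hqf p, h1, map_zero])

/-- For injective simple `S`, a map `rad P(S) → P(S)` has image in the radical. -/
theorem IsProjCover.apply_mem_radM (hcov : IsProjCover A π) (hinj : Module.Injective A S)
    (g : radM A P →ₗ[A] P) (m : radM A P) : g m ∈ radM A P := by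
  obtain ⟨h, hh⟩ := hinj.out (radM A P).subtype (Submodule.subtype_injective _) (π ∘ₗ g)
  refine hcov.ker_eq_radM.le ?_
  rw [LinearMap.mem_ker, ← LinearMap.comp_apply, ← hh]
  exact radM_le_ker h m.2

/-- Endomorphisms of `S` lift to `P(S)` and restrict to the radical, if `S` is injective. -/
theorem IsProjCover.exists_ringHom (hcov : IsProjCover A π) (hinj : Module.Injective A S) :
    ∃ ρ : Module.End A S →+* Module.End A (radM A P), ∀ (d : Module.End A S) (f : P →ₗ[A] P),
      (∀ p, π (f p) = d (π p)) → ∀ m, (ρ d m : P) = f m := by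
  have := hcov.1
  have hL : ∀ d : Module.End A S, ∃ f : P →ₗ[A] P, ∀ p, π (f p) = d (π p) := fun d => by
    obtain ⟨f, hf⟩ := Module.projective_lifting_property π (d ∘ₗ π) hcov.2.2.1
    exact ⟨f, LinearMap.congr_fun hf⟩
  choose L hL using hL
  have huniq : ∀ (d : Module.End A S) (f : P →ₗ[A] P), (∀ p, π (f p) = d (π p)) → L d = f :=
    fun d f hf => hcov.endomorphism_ext hinj fun p => by rw [hL, hf]
  have hmap : ∀ d, ∀ m ∈ radM A P, L d m ∈ radM A P := fun d m hm => by
    rw [← hcov.ker_eq_radM] at hm ⊢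
    rw [LinearMap.mem_ker, hL, LinearMap.mem_ker.1 hm, map_zero]
  refine ⟨{ toFun := fun d => (L d).restrict (hmap d), map_one' := ?_, map_mul' := ?_,
            map_zero' := ?_, map_add' := ?_ }, fun d f hf m => by
      change L d m = f m
      rw [huniq d f hf]⟩
  · ext m
    simp [huniq 1 LinearMap.id (fun p => rfl)]
  · intro x y
    ext m
    simp [huniq (x * y) (L x ∘ₗ L y) (fun p => by simp [hL])]
  · ext m
    simp [huniq 0 0 (fun p => by simp)]
  · intro x y
    ext m
    simp [huniq (x + y) (L x + L y) (fun p => by simp [hL])]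

/-- For a finitely generated module, extending maps along `ι` to the free module of rank one
suffices to extend maps to all projective modules. -/
theorem exists_extension_of_projective {M : Type u} [AddCommGroup M] [Module A M]
    [Module.Finite A M] (ι : M →ₗ[A] P)
    (hA : ∀ g : M →ₗ[A] A, ∃ h : P →ₗ[A] A, h ∘ₗ ι = g)
    (X : Type u) [AddCommGroup X] [Module A X] [hX : Module.Projective A X] (g : M →ₗ[A] X) :
    ∃ h : P →ₗ[A] X, h ∘ₗ ι = g := by
  classical
  obtain ⟨s, hs⟩ := hX.out
  choose H hH using fun i : X => hA (Finsupp.lapply i ∘ₗ s ∘ₗ g)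
  obtain ⟨G, hG⟩ := Module.Finite.fg_top (R := A) (M := M)
  let J : Finset X := G.biUnion fun m => (s (g m)).support
  refine ⟨Finsupp.linearCombination A id ∘ₗ ∑ i ∈ J, Finsupp.lsingle i ∘ₗ H i,
    LinearMap.ext_on hG fun m hm => ?_⟩
  have hJ : (s (g m)).support ⊆ J := Finset.subset_biUnion_of_mem (fun m => (s (g m)).support) hm
  have key : (∑ i ∈ J, Finsupp.lsingle i ∘ₗ H i) (ι m) = s (g m) := by
    have hi : ∀ i, H i (ι m) = s (g m) i := fun i => LinearMap.congr_fun (hH i) m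
    rw [LinearMap.sum_apply]
    simp only [LinearMap.comp_apply, Finsupp.lsingle_apply, hi]
    conv_rhs => rw [← Finsupp.sum_single (s (g m))]
    exact (Finsupp.sum_of_support_subset _ hJ _ (by simp)).symm
  rw [LinearMap.comp_apply, LinearMap.comp_apply, key]
  exact hs (g m)

/-- The factor algebra `A/AeA` as a left `A`-module. -/
abbrev BquotModule (A : Type u) [Ring A] (e : A) : Type u :=
  ↥((ModuleCat.restrictScalars (Bproj A e)).obj (ModuleCat.of (Bquot A e) (Bquot A e)))

/-- The projection `A → A/AeA` as a map of left `A`-modules. -/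
def BprojLinear (A : Type u) [Ring A] (e : A) : A →ₗ[A] BquotModule A e where
  toFun a := Bproj A e a
  map_add' a b := map_add (Bproj A e) a b
  map_smul' a b := map_mul (Bproj A e) a b

theorem BprojLinear_surjective (e : A) : Function.Surjective (BprojLinear A e) :=
  RingCon.mk'_surjective _

theorem smul_BquotModule_eq_zero (e : A) (b : BquotModule A e) : e • b = 0 := by
  obtain ⟨a, rfl⟩ := BprojLinear_surjective e b
  rw [← map_smul]
  refine (RingCon.eq _).2 ?_
  exact (TwoSidedIdeal.mem_iff _ _).1
    (TwoSidedIdeal.mul_mem_right _ _ _ (TwoSidedIdeal.subset_span rfl))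

theorem BprojLinear_ker_le {e : A} {X : Type*} [AddCommGroup X] [Module A X] (r : A →ₗ[A] X)
    (hr : ∀ x, e • r x = 0) : ker (BprojLinear A e) ≤ ker r := by
  intro x hx
  have hx' : x ∈ TwoSidedIdeal.span {e} := (TwoSidedIdeal.mem_iff _ _).2 ((RingCon.eq _).1 hx)
  have hall : ∀ y, r (x * y) = 0 := by
    let I : TwoSidedIdeal A := TwoSidedIdeal.mk' {x | ∀ y, r (x * y) = 0} (by simp)
      (fun {x y} hx hy z => by rw [add_mul, map_add, hx, hy, add_zero])
      (fun {x} hx z => by rw [neg_mul, map_neg, hx, neg_zero])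
      (fun {x y} hy z => by rw [mul_assoc, ← smul_eq_mul, map_smul, hy, smul_zero])
      (fun {x y} hx z => by rw [mul_assoc, hx])
    have hI : x ∈ I := TwoSidedIdeal.mem_span_iff.1 hx' I (by
      rintro _ rfl
      rw [SetLike.mem_coe, TwoSidedIdeal.mem_mk']
      intro y
      rw [← smul_eq_mul, map_smul, hr])
    rwa [TwoSidedIdeal.mem_mk'] at hI
  simpa using hall 1

end RadicalApproximation

/-- 3.6(e): for `M = rad P(S) ≠ 0`, the inclusion `M → P(S)` is a left
`add(A)`-approximation iff `End_A(M)` is isomorphic to `D = End(S)` as a `k`-algebra and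
`Hom_A(M, B) = 0`. -/
theorem radical_inclusion_is_approximation_iff (k : Type u) [CommRing k] [IsArtinianRing k]
    (A : Type u) [Ring A] [Algebra k A] [Module.Finite k A]
    (e₀ : A) (he₀ : IsPrimIdem A e₀)
    (S : Type u) [AddCommGroup S] [Module A S] [Module.Finite A S]
    (hsimple : IsSimpleModule A S) (hinjective : Module.Injective A S)
    (heS : ∃ s : S, e₀ • s ≠ 0)
    (PS : Type u) [AddCommGroup PS] [Module A PS]
    (eP : PS →ₗ[A] S) (hcov : IsProjCover A eP)
    (hM0 : radM A PS ≠ ⊥) :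
    IsLeftAddApprox A (radM A PS).subtype ↔
      ((∃ φ : (Module.End A (↥(radM A PS))) ≃+* (Module.End A S),
          ∀ c : k, φ (centralSMul k A c (↥(radM A PS))) = centralSMul k A c S) ∧
        (∀ gB : (↥(radM A PS)) →ₗ[A]
            (↥((ModuleCat.restrictScalars (Bproj A e₀)).obj
              (ModuleCat.of (Bquot A e₀) (Bquot A e₀)))),
          gB = 0)) := by
  have hS := hsimple
  have hproj := hcov.1
  have hfin := hcov.2.1
  have hArt : IsArtinian A A := isArtinian_of_tower k inferInstance
  have hNoeth : IsNoetherian A A := isNoetherian_of_tower k inferInstance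
  have hPN : IsNoetherian A PS := isNoetherian_of_isNoetherianRing_of_finite A PS
  have hMnt : Nontrivial (radM A PS) := Submodule.nontrivial_iff_ne_bot.2 hM0
  obtain ⟨ρ, hρ⟩ := hcov.exists_ringHom hinjective
  have hρinj : Function.Injective ρ := by
    classical exact ρ.injective
  have hρk : ∀ c : k, ρ (centralSMul k A c S) = centralSMul k A c (radM A PS) := fun c => by
    ext m
    exact hρ _ (centralSMul k A c PS) (fun p => map_smul eP _ _) m
  obtain ⟨p, hp, -, htop, -⟩ := hcov.exists_generator he₀ heS
  have hPB : ∀ f : PS →ₗ[A] BquotModule A e₀, f = 0 := fun f =>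
    LinearMap.ext_on htop fun x hx => by
      obtain rfl : x = p := hx
      rw [← hp, map_smul, smul_BquotModule_eq_zero]
      rfl
  obtain ⟨r, hr, hrI⟩ := hcov.exists_projection hinjective he₀ heS A
  have hker := BprojLinear_ker_le r hr
  constructor
  · rintro ⟨-, -, happ⟩
    refine ⟨?_, fun gB => ?_⟩
    · have hρsurj : Function.Surjective ρ := fun f => by
        obtain ⟨h, hh⟩ := happ (ModuleCat.of A PS) hproj ((radM A PS).subtype ∘ₗ f)
        obtain ⟨d, hd⟩ := exists_comp_eq_of_ker_le eP hcov.2.2.1 (eP ∘ₗ h)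
          (hcov.ker_eq_radM.trans_le (radM_le_ker _))
        refine ⟨d, ?_⟩
        ext m
        rw [hρ d h (fun p => (hd p).symm)]
        exact LinearMap.congr_fun hh m
      refine ⟨(RingEquiv.ofBijective ρ ⟨hρinj, hρsurj⟩).symm, fun c => ?_⟩
      rw [RingEquiv.symm_apply_eq]
      exact (hρk c).symm
    · obtain ⟨σ, hσ⟩ := exists_comp_eq_of_ker_le _ (BprojLinear_surjective e₀) r hker
      have hπr : ∀ x, BprojLinear A e₀ (r x) = BprojLinear A e₀ x := by
        have : BprojLinear A e₀ ∘ₗ (LinearMap.id - r) = 0 := by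
          refine AddSubgroup.closure_induction (p := fun t _ => BprojLinear A e₀ ∘ₗ t = 0)
            ?_ ?_ ?_ ?_ hrI
          · rintro _ ⟨s, q, rfl⟩
            rw [← LinearMap.comp_assoc, hPB (BprojLinear A e₀ ∘ₗ s), LinearMap.zero_comp]
          · exact LinearMap.comp_zero _
          · intro x y _ _ hx hy
            rw [LinearMap.comp_add, hx, hy, add_zero]
          · intro x _ hx
            rw [LinearMap.comp_neg, hx, neg_zero]
        intro x
        have h := LinearMap.congr_fun this x
        rw [LinearMap.comp_apply, LinearMap.sub_apply, map_sub] at h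
        exact (sub_eq_zero.1 h).symm
      have hπσ : ∀ b, BprojLinear A e₀ (σ b) = b := fun b => by
        obtain ⟨a, rfl⟩ := BprojLinear_surjective e₀ b
        rw [hσ, hπr]
      obtain ⟨h, hh⟩ := happ (ModuleCat.of A A) inferInstance (σ ∘ₗ gB)
      ext1 m
      rw [← hπσ (gB m)]
      have h1 : h m = σ (gB m) := LinearMap.congr_fun hh m
      rw [← h1]
      exact LinearMap.congr_fun (hPB (BprojLinear A e₀ ∘ₗ h)) m
  · rintro ⟨⟨φ, hφ⟩, hB⟩
    have hρsurj : Function.Surjective ρ := by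
      let _ : Module k S := Module.compHom S (algebraMap k A)
      have : IsScalarTower k A S := ⟨fun c a s => by
        rw [Algebra.smul_def, mul_smul]; rfl⟩
      have hSfin : Module.Finite k S := Module.Finite.trans A S
      have : SMulCommClass A k S := ⟨fun a c s => by
        change a • algebraMap k A c • s = algebraMap k A c • a • s
        rw [← mul_smul, ← mul_smul, Algebra.commutes]⟩
      have := IsSimpleModule.nontrivial A S
      obtain ⟨s, hs⟩ := exists_ne (0 : S)
      have hDart : IsArtinian k (Module.End A S) := by
        let ev : Module.End A S →ₗ[k] S :=
          { toFun := fun f => f s, map_add' := fun _ _ => rfl, map_smul' := fun _ _ => rfl }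
        refine isArtinian_of_injective ev fun f g hfg => ?_
        exact LinearMap.ext_on (IsSimpleModule.span_singleton_eq_top A hs) fun x hx => by
          obtain rfl : x = s := hx
          exact hfg
      let t : Module.End A S →ₗ[k] Module.End A S :=
        { toFun := fun d => φ (ρ d)
          map_add' := fun x y => by simp
          map_smul' := fun c d => by
            have : c • d = centralSMul k A c S * d := rfl
            rw [this, map_mul, map_mul, hρk, hφ]
            rfl }
      have ht : Function.Surjective t :=
        IsArtinian.surjective_of_injective_endomorphism t (φ.injective.comp hρinj)
      intro f
      obtain ⟨d, hd⟩ := ht (φ f)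
      exact ⟨d, φ.injective hd⟩
    have hMP : ∀ g : radM A PS →ₗ[A] PS, ∃ h : PS →ₗ[A] PS, h ∘ₗ (radM A PS).subtype = g :=
      fun g => by
        obtain ⟨d, hd⟩ := hρsurj (g.codRestrict _ (hcov.apply_mem_radM hinjective g))
        obtain ⟨h, hh⟩ := Module.projective_lifting_property eP (d ∘ₗ eP) hcov.2.2.1
        refine ⟨h, LinearMap.ext fun m => ?_⟩
        have := hρ d h (LinearMap.congr_fun hh) m
        rw [hd] at this
        exact this.symm
    refine ⟨hproj, hfin, fun P' hP' g => exists_extension_of_projective _ (fun g => ?_) P' g⟩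
    have hrg : ∀ m, r (g m) = 0 := fun m =>
      hker (LinearMap.congr_fun (hB (BprojLinear A e₀ ∘ₗ g)) m)
    have hg : g = (LinearMap.id - r) ∘ₗ g := by
      ext m
      simp [hrg]
    rw [hg]
    refine AddSubgroup.closure_induction
      (p := fun t _ => ∃ h : PS →ₗ[A] A, h ∘ₗ (radM A PS).subtype = t ∘ₗ g) ?_ ?_ ?_ ?_ hrI
    · rintro _ ⟨s, q, rfl⟩
      obtain ⟨h, hh⟩ := hMP (q ∘ₗ g)
      exact ⟨s ∘ₗ h, by rw [LinearMap.comp_assoc, hh, LinearMap.comp_assoc]⟩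
    · exact ⟨0, by simp⟩
    · rintro x y _ _ ⟨h, hh⟩ ⟨h', hh'⟩
      exact ⟨h + h', by rw [LinearMap.add_comp, hh, hh', LinearMap.add_comp]⟩
    · rintro x _ ⟨h, hh⟩
      exact ⟨-h, by rw [LinearMap.neg_comp, hh, LinearMap.neg_comp]⟩
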